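/- Let F be a field and let x,y,w ∈ F with x,y,w ≠ 0, x ≠ 1, w ≠ 1, x+y−xy ≠ 0 and w ≠ x+y−xy, and set z = 1 − (1−x)(1−y)/(1−w) (which is then nonzero). Then in the fourth exterior power over ℚ of the ℚ-vector space ℚ ⊗_ℤ Fˣ, one has x∧y∧w∧z = x^{−1}∧(1−x^{−1})∧w∧z + (y−y/x)∧(1−y+y/x)∧w∧(z(1−w)) + ((x+y−xy)/w)∧(1−(x+y−xy)/w)∧(y−y/x)∧w − w∧(1−w)∧x∧(y−y/x). -/

import Mathlib

open scoped TensorProduct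
open scoped Classical

set_option synthInstance.maxHeartbeats 1000000
set_option maxHeartbeats 1000000

/-- The image of a nonzero field element in the exterior algebra (over `ℚ`) of the
`ℚ`-vector space `ℚ ⊗_ℤ Fˣ`; zero is sent to `0`.  Wedge products of units are then
given by multiplication in the exterior algebra. -/
noncomputable def wedgeGen (F : Type) [Field F] (u : F) :
    ExteriorAlgebra ℚ (ℚ ⊗[ℤ] Additive Fˣ) :=
  if h : u = 0 then 0
  else ExteriorAlgebra.ι ℚ ((1 : ℚ) ⊗ₜ[ℤ] (Additive.ofMul (Units.mk0 u h)))

theorem wedgeGen_eq_ι {F : Type} [Field F] {u : F} (hu : u ≠ 0) :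
    wedgeGen F u =
      ExteriorAlgebra.ι ℚ ((1 : ℚ) ⊗ₜ[ℤ] (Additive.ofMul (Units.mk0 u hu))) :=
  dif_neg hu

theorem wedgeGen_mul {F : Type} [Field F] {u v : F} (hu : u ≠ 0) (hv : v ≠ 0) :
    wedgeGen F (u * v) = wedgeGen F u + wedgeGen F v := by
  rw [wedgeGen_eq_ι hu, wedgeGen_eq_ι hv, wedgeGen_eq_ι (mul_ne_zero hu hv), ← map_add,
    ← TensorProduct.tmul_add, ← ofMul_mul, Units.mk0_mul]

theorem wedgeGen_one (F : Type) [Field F] : wedgeGen F 1 = 0 := by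
  simpa using wedgeGen_mul (one_ne_zero (α := F)) one_ne_zero

theorem wedgeGen_inv {F : Type} [Field F] {u : F} (hu : u ≠ 0) :
    wedgeGen F u⁻¹ = -wedgeGen F u := by
  rw [eq_neg_iff_add_eq_zero, ← wedgeGen_mul (inv_ne_zero hu) hu, inv_mul_cancel₀ hu,
    wedgeGen_one]

theorem wedgeGen_div {F : Type} [Field F] {u v : F} (hu : u ≠ 0) (hv : v ≠ 0) :
    wedgeGen F (u / v) = wedgeGen F u - wedgeGen F v := by
  rw [div_eq_mul_inv, wedgeGen_mul hu (inv_ne_zero hv), wedgeGen_inv hv, sub_eq_add_neg]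

theorem wedgeGen_neg_one (F : Type) [Field F] : wedgeGen F (-1) = 0 := by
  have h := wedgeGen_mul (neg_ne_zero.2 (one_ne_zero (α := F))) (neg_ne_zero.2 one_ne_zero)
  rw [neg_one_mul, neg_neg, wedgeGen_one, ← two_smul ℚ] at h
  exact (smul_eq_zero.1 h.symm).resolve_left two_ne_zero

theorem wedgeGen_neg {F : Type} [Field F] {u : F} (hu : u ≠ 0) :
    wedgeGen F (-u) = wedgeGen F u := by
  rw [← neg_one_mul, wedgeGen_mul (neg_ne_zero.2 one_ne_zero) hu, wedgeGen_neg_one, zero_add]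

theorem wedgeGen_mul_self {F : Type} [Field F] (u : F) :
    wedgeGen F u * wedgeGen F u = 0 := by
  by_cases hu : u = 0
  · simp [wedgeGen, hu]
  · rw [wedgeGen_eq_ι hu, ExteriorAlgebra.ι_sq_zero]

theorem wedgeGen_anticomm {F : Type} [Field F] (u v : F) :
    wedgeGen F u * wedgeGen F v = -(wedgeGen F v * wedgeGen F u) := by
  by_cases hu : u = 0
  · simp [wedgeGen, hu]
  by_cases hv : v = 0
  · simp [wedgeGen, hv]
  rw [eq_neg_iff_add_eq_zero, wedgeGen_eq_ι hu, wedgeGen_eq_ι hv, ExteriorAlgebra.ι_add_mul_swap]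

/-- The wedge identity in terms of the symbols `X = [x]`, `Y = [y]`, `W = [w]`, `A = [x - 1]`,
`S = [x + y - xy]`, `B = [1 - w]`, `D = [x + y - xy - w]`. -/
theorem wedge_identity_of_anticomm {R : Type*} [Ring R] (s : Set R)
    (sq : ∀ a ∈ s, a * a = 0) (anti : ∀ a ∈ s, ∀ b ∈ s, a * b = -(b * a))
    {X Y W A S B D : R} (hX : X ∈ s) (hY : Y ∈ s) (hW : W ∈ s) (hA : A ∈ s) (hS : S ∈ s)
    (hB : B ∈ s) (hD : D ∈ s) :
    X * Y * W * (D - B) =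
      -X * (A - X) * W * (D - B) + (Y + A - X) * (S - X) * W * D
        + (S - W) * (D - W) * (Y + A - X) * W - W * B * X * (Y + A - X) := by
  have anti' : ∀ a ∈ s, ∀ b ∈ s, ∀ c, a * (b * c) = -(b * (a * c)) := fun a ha b hb c => by
    rw [← mul_assoc, anti a ha b hb, neg_mul, mul_assoc]
  have sq' : ∀ a ∈ s, ∀ c, a * (a * c) = 0 := fun a ha c => by
    rw [← mul_assoc, sq a ha, zero_mul]
  simp only [mul_assoc, mul_add, add_mul, mul_sub, sub_mul, neg_mul, mul_neg, sq X hX, sq' X hX,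
    sq W hW, sq' W hW, anti Y hY X hX, anti A hA X hX, anti' S hS X hX, anti' S hS Y hY,
    anti' S hS A hA, anti W hW X hX, anti' W hW X hX, anti W hW Y hY, anti' W hW Y hY,
    anti W hW A hA, anti' W hW A hA, anti D hD X hX, anti D hD Y hY, anti D hD A hA,
    anti D hD W hW, anti B hB X hX, anti B hB Y hY, anti B hB A hA, mul_zero, zero_mul,
    neg_zero]
  abel

/-- With `z = 1 - (1-x)(1-y)/(1-w)`, one has, in `Λ⁴` of `ℚ ⊗_ℤ Fˣ`:
`x∧y∧w∧z = x⁻¹∧(1-x⁻¹)∧w∧z + (y-y/x)∧(1-y+y/x)∧w∧(z(1-w))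
  + ((x+y-xy)/w)∧(1-(x+y-xy)/w)∧(y-y/x)∧w - w∧(1-w)∧x∧(y-y/x)`. -/
theorem wedge_identity_four_var (F : Type) [Field F] (x y w : F)
    (hx0 : x ≠ 0) (hy0 : y ≠ 0) (hw0 : w ≠ 0) (hx1 : x ≠ 1) (hw1 : w ≠ 1)
    (hs : x + y - x * y ≠ 0) (hws : w ≠ x + y - x * y)
    (z : F) (hz : z = 1 - (1 - x) * (1 - y) / (1 - w)) :
    wedgeGen F x * wedgeGen F y * wedgeGen F w * wedgeGen F z
      = wedgeGen F x⁻¹ * wedgeGen F (1 - x⁻¹) * wedgeGen F w * wedgeGen F z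
        + wedgeGen F (y - y / x) * wedgeGen F (1 - y + y / x) * wedgeGen F w *
            wedgeGen F (z * (1 - w))
        + wedgeGen F ((x + y - x * y) / w) * wedgeGen F (1 - (x + y - x * y) / w) *
            wedgeGen F (y - y / x) * wedgeGen F w
        - wedgeGen F w * wedgeGen F (1 - w) * wedgeGen F x * wedgeGen F (y - y / x) := by
  have hx : x - 1 ≠ 0 := sub_ne_zero.2 hx1
  have hw : 1 - w ≠ 0 := sub_ne_zero.2 hw1.symm
  have hd : x + y - x * y - w ≠ 0 := sub_ne_zero.2 hws.symm
  have ez : z = (x + y - x * y - w) / (1 - w) := by rw [hz]; field_simp; ring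
  have ezw : z * (1 - w) = x + y - x * y - w := by rw [ez, div_mul_cancel₀ _ hw]
  have e₁ : 1 - x⁻¹ = (x - 1) / x := by field_simp
  have e₂ : y - y / x = y * (x - 1) / x := by field_simp
  have e₃ : 1 - y + y / x = (x + y - x * y) / x := by field_simp; ring
  have e₄ : 1 - (x + y - x * y) / w = -(x + y - x * y - w) / w := by field_simp; ring
  rw [ezw, ez, e₁, e₂, e₃, e₄, wedgeGen_div hd hw, wedgeGen_inv hx0, wedgeGen_div hx hx0,
    wedgeGen_div (mul_ne_zero hy0 hx) hx0, wedgeGen_mul hy0 hx, wedgeGen_div hs hx0,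
    wedgeGen_div hs hw0, wedgeGen_div (neg_ne_zero.2 hd) hw0, wedgeGen_neg hd]
  apply wedge_identity_of_anticomm (Set.range (wedgeGen F)) <;>
    simp [wedgeGen_mul_self, ← wedgeGen_anticomm]
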